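/- arXiv:2201.05879 — 2 statements merged into one kernel-verified Lean document; each statement's English description precedes it below -/
import Mathlib

section
/- For n ≥ 1, OR_n · OP_n = OP_n · OR_n = OR_n: the composite (in either order) of an orientation-reversing map and an orientation-preserving map of [n] is orientation-reversing, and every orientation-reversing map arises as such a composite in either order. -/
/-- A finite sequence `a : Fin t → α` is *cyclic* if there is at most one index `i`
(indices modulo `t`) with `a i > a (i+1)`. -/
def IsCyclicSeq {t : ℕ} {α : Type*} [LinearOrder α] (a : Fin t → α) : Prop :=
  (Finset.univ.filter fun i : Fin t => a (finRotate t i) < a i).card ≤ 1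

/-- A finite sequence `a : Fin t → α` is *anti-cyclic* if there is at most one index `i`
(indices modulo `t`) with `a i < a (i+1)`. -/
def IsAntiCyclicSeq {t : ℕ} {α : Type*} [LinearOrder α] (a : Fin t → α) : Prop :=
  (Finset.univ.filter fun i : Fin t => a i < a (finRotate t i)).card ≤ 1

/-- A sequence is *oriented* if it is cyclic or anti-cyclic. -/
def IsOrientedSeq {t : ℕ} {α : Type*} [LinearOrder α] (a : Fin t → α) : Prop :=
  IsCyclicSeq a ∨ IsAntiCyclicSeq a

/-- `u` records on which sheet each entry of `a` lies: entries on a common sheet increase,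
and entries on the next sheet do not overtake the earlier ones. -/
def IsSheet {t : ℕ} {α : Type*} [LinearOrder α] (a : Fin t → α) (u : Fin t → ℤ) : Prop :=
  ∀ i j, i ≤ j → u i ≤ u j ∧ u j ≤ u i + 1 ∧ (u i = u j → a i ≤ a j) ∧ (u i < u j → a j ≤ a i)

theorem IsSheet.comp {t s : ℕ} {γ : Type*} [LinearOrder γ] {a : Fin t → Fin s} {b : Fin s → γ}
    {u : Fin t → ℤ} {v : Fin s → ℤ} (ha : IsSheet a u) (hb : IsSheet b v) :
    IsSheet (fun i => b (a i)) (fun i => u i + v (a i)) := by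
  intro i j hij
  obtain ⟨h₁, h₂, h₃, h₄⟩ := ha i j hij
  beta_reduce
  rcases h₁.eq_or_lt with h | h
  · obtain ⟨k₁, k₂, k₃, k₄⟩ := hb _ _ (h₃ h)
    exact ⟨by omega, by omega, fun e => k₃ (by omega), fun e => k₄ (by omega)⟩
  · obtain ⟨k₁, k₂, k₃, k₄⟩ := hb _ _ (h₄ h)
    exact ⟨by omega, by omega, fun e => k₄ (by omega), fun e => k₃ (by omega)⟩

theorem isCyclicSeq_iff {t : ℕ} {α : Type*} [LinearOrder α] {a : Fin t → α} :
    IsCyclicSeq a ↔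
      ∀ i j, a (finRotate t i) < a i → a (finRotate t j) < a j → i = j := by
  simp only [IsCyclicSeq, Finset.card_le_one, Finset.mem_filter, Finset.mem_univ, true_and]
  grind

theorem le_of_forall_not_descent {m : ℕ} {α : Type*} [LinearOrder α] {a : Fin (m + 1) → α}
    {i j : Fin (m + 1)} (hij : i ≤ j)
    (h : ∀ d, i ≤ d → d < j → ¬ a (finRotate (m + 1) d) < a d) : a i ≤ a j := by
  obtain ⟨j, hj⟩ := j
  induction j with
  | zero => exact (congrArg a (Fin.le_zero_iff.1 hij)).le
  | succ k ih =>
    rcases hij.eq_or_lt with rfl | hlt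
    · exact le_rfl
    · have hik : i ≤ ⟨k, by omega⟩ := Nat.lt_succ_iff.1 hlt
      have hstep := h ⟨k, by omega⟩ hik (Nat.lt_succ_self k)
      rw [finRotate_of_lt (by omega), not_lt] at hstep
      exact (ih (by omega) hik fun d h₁ h₂ => h d h₁ (h₂.trans (Nat.lt_succ_self k))).trans hstep

theorem IsSheet.isCyclicSeq {m : ℕ} {α : Type*} [LinearOrder α] {a : Fin (m + 1) → α}
    {u : Fin (m + 1) → ℤ} (hu : IsSheet a u) : IsCyclicSeq a := by
  have step (d : Fin (m + 1)) (hd : d.val < m) (h : a (finRotate (m + 1) d) < a d) :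
      u d < u (finRotate (m + 1) d) := by
    have hle : d ≤ finRotate (m + 1) d := by
      rw [Fin.le_def, coe_finRotate_of_ne_last (by rintro rfl; simp at hd)]
      omega
    obtain ⟨h₁, -, h₃, -⟩ := hu _ _ hle
    exact h₁.lt_of_ne fun e => (h₃ e).not_gt h
  have not_two (i j : Fin (m + 1)) (hij : i < j) (hi : a (finRotate (m + 1) i) < a i)
      (hj : a (finRotate (m + 1) j) < a j) : False := by
    have him : i.val < m := by omega
    have hi' := step i him hi
    have hle : finRotate (m + 1) i ≤ j := by
      rw [Fin.le_def, coe_finRotate_of_ne_last (by rintro rfl; simp at him)]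
      omega
    have h₁ := (hu _ _ hle).1
    by_cases hjm : j.val < m
    · have hj' := step j hjm hj
      have hij' : i ≤ finRotate (m + 1) j := by
        rw [Fin.le_def, coe_finRotate_of_ne_last (by rintro rfl; simp at hjm)]
        omega
      have := (hu _ _ hij').2.1
      omega
    · obtain rfl : j = Fin.last m := Fin.ext (by simp; omega)
      rw [finRotate_last] at hj
      have h₀ := (hu 0 i (Fin.zero_le i)).1
      exact ((hu 0 (Fin.last m) (Fin.zero_le _)).2.2.2 (by omega)).not_gt hj
  rw [isCyclicSeq_iff]
  intro i j hi hj
  rcases lt_trichotomy i j with h | h | h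
  · exact (not_two i j h hi hj).elim
  · exact h
  · exact (not_two j i h hj hi).elim

theorem IsCyclicSeq.exists_isSheet {m : ℕ} {α : Type*} [LinearOrder α] {a : Fin (m + 1) → α}
    (ha : IsCyclicSeq a) : ∃ u, IsSheet a u := by
  classical
  rw [isCyclicSeq_iff] at ha
  by_cases hex : ∃ d, a (finRotate (m + 1) d) < a d
  · obtain ⟨d, hd⟩ := hex
    have huniq (e : Fin (m + 1)) (hne : e ≠ d) : ¬ a (finRotate (m + 1) e) < a e :=
      fun he => hne (ha e d he hd)
    refine ⟨fun i => if d < i then 1 else 0, fun i j hij => ?_⟩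
    by_cases hi : d < i
    · have hj := hi.trans_le hij
      simpa [hi, hj] using le_of_forall_not_descent hij fun e he _ => huniq e (hi.trans_le he).ne'
    · by_cases hj : d < j
      · have h₁ : a j ≤ a (Fin.last m) := le_of_forall_not_descent (Fin.le_last j)
          fun e he _ => huniq e (hj.trans_le he).ne'
        have h₂ : a (Fin.last m) ≤ a 0 := by
          simpa using huniq (Fin.last m) (hj.trans_le (Fin.le_last j)).ne'
        have h₃ : a 0 ≤ a i := le_of_forall_not_descent (Fin.zero_le i)
          fun e _ he => huniq e (he.trans_le (not_lt.1 hi)).ne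
        simpa [hi, hj] using h₁.trans (h₂.trans h₃)
      · simpa [hi, hj] using le_of_forall_not_descent hij
          fun e _ he => huniq e (he.trans_le (not_lt.1 hj)).ne
  · exact ⟨fun _ => 0, fun i j hij => by
      simpa using le_of_forall_not_descent hij fun e _ _ he => hex ⟨e, he⟩⟩

theorem isCyclicSeq_iff_exists_isSheet {m : ℕ} {α : Type*} [LinearOrder α]
    {a : Fin (m + 1) → α} : IsCyclicSeq a ↔ ∃ u, IsSheet a u :=
  ⟨IsCyclicSeq.exists_isSheet, fun ⟨_, hu⟩ => hu.isCyclicSeq⟩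

theorem IsCyclicSeq.comp {n : ℕ} {α β : Fin n → Fin n} (hα : IsCyclicSeq α)
    (hβ : IsCyclicSeq β) : IsCyclicSeq fun x => β (α x) := by
  cases n with
  | zero => simp [IsCyclicSeq]
  | succ m =>
    obtain ⟨u, hu⟩ := hα.exists_isSheet
    obtain ⟨v, hv⟩ := hβ.exists_isSheet
    exact (hu.comp hv).isCyclicSeq

theorem isCyclicSeq_rev_comp {t n : ℕ} {a : Fin t → Fin n} :
    IsCyclicSeq (fun i => (a i).rev) ↔ IsAntiCyclicSeq a := by
  simp [IsCyclicSeq, IsAntiCyclicSeq, Fin.rev_lt_rev]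

theorem finRotate_rev_finRotate {t : ℕ} (i : Fin t) :
    finRotate t (finRotate t i).rev = i.rev := by
  cases t with
  | zero => exact i.elim0
  | succ m =>
    rcases eq_or_ne i (Fin.last m) with rfl | hi
    · simp
    · have hval := coe_finRotate_of_ne_last hi
      have hne : (finRotate (m + 1) i).rev ≠ Fin.last m := by
        intro h
        have := congrArg Fin.val h
        simp only [Fin.val_rev, Fin.val_last] at this
        omega
      ext
      rw [coe_finRotate_of_ne_last hne]
      simp only [Fin.val_rev]
      omega

theorem isCyclicSeq_comp_rev {t : ℕ} {α : Type*} [LinearOrder α] {a : Fin t → α} :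
    IsCyclicSeq (fun i => a i.rev) ↔ IsAntiCyclicSeq a := by
  unfold IsCyclicSeq IsAntiCyclicSeq
  rw [Finset.card_equiv ((finRotate t).trans Fin.revPerm) fun i => ?_]
  simp only [Finset.mem_filter, Finset.mem_univ, true_and, Equiv.trans_apply, Fin.revPerm_apply,
    finRotate_rev_finRotate]

/-- `OR_n · OP_n = OP_n · OR_n = OR_n` (composites written on the right:
`αβ` is first `α`, then `β`). -/
theorem or_op_mul (n : ℕ) (hn : 1 ≤ n) (f : Fin n → Fin n) :
    ((∃ α β : Fin n → Fin n, IsAntiCyclicSeq α ∧ IsCyclicSeq β ∧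
        f = fun x => β (α x)) ↔ IsAntiCyclicSeq f) ∧
    ((∃ α β : Fin n → Fin n, IsCyclicSeq α ∧ IsAntiCyclicSeq β ∧
        f = fun x => β (α x)) ↔ IsAntiCyclicSeq f) := by
  have id_cyclic : IsCyclicSeq (fun x : Fin n => x) := by
    obtain ⟨m, rfl⟩ : ∃ m, n = m + 1 := ⟨n - 1, by omega⟩
    exact isCyclicSeq_iff_exists_isSheet.2 ⟨fun _ => 0, fun i j hij => by simpa using hij⟩
  refine ⟨⟨?_, fun hf => ⟨f, fun x => x, hf, id_cyclic, rfl⟩⟩,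
    ⟨?_, fun hf => ⟨fun x => x, f, id_cyclic, hf, rfl⟩⟩⟩
  · rintro ⟨α, β, hα, hβ, rfl⟩
    rw [← isCyclicSeq_comp_rev] at hα ⊢
    exact hα.comp hβ
  · rintro ⟨α, β, hα, hβ, rfl⟩
    rw [← isCyclicSeq_rev_comp] at hβ ⊢
    exact hα.comp hβ
end

section
/- A map α : [n] → [n] has the chord property if and only if α ∈ P_n = OP_n ∪ OR_n. -/
/-- The point of `[n]` labelled `k`, placed clockwise on the unit circle. -/
noncomputable def circlePt (n : ℕ) (k : Fin n) : ℝ × ℝ :=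
  (Real.cos (2 * Real.pi * (k.val : ℝ) / n), -Real.sin (2 * Real.pi * (k.val : ℝ) / n))

/-- `α` has the *chord property* if it preserves nonempty intersection of chords. -/
def ChordProperty (n : ℕ) (α : Fin n → Fin n) : Prop :=
  ∀ a b c d : Fin n,
    (segment ℝ (circlePt n a) (circlePt n c) ∩ segment ℝ (circlePt n b) (circlePt n d)).Nonempty →
    (segment ℝ (circlePt n (α a)) (circlePt n (α c)) ∩
      segment ℝ (circlePt n (α b)) (circlePt n (α d))).Nonempty

/-- `x`, `y`, `z` are distinct and in increasing cyclic order. -/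
def CyclicLT (x y z : ℕ) : Prop :=
  (x < y ∧ y < z) ∨ (y < z ∧ z < x) ∨ (z < x ∧ x < y)

/-- The pairs `{a, c}` and `{b, d}` share an element or separate each other on the circle. -/
def Interlaced (a c b d : ℕ) : Prop :=
  a = b ∨ a = d ∨ c = b ∨ c = d ∨
    (CyclicLT a b c ∧ CyclicLT c d a) ∨ (CyclicLT a d c ∧ CyclicLT c b a)

lemma CyclicLT.rotate {x y z : ℕ} (h : CyclicLT x y z) : CyclicLT y z x := by
  unfold CyclicLT at *; omega

lemma cyclicLT_or_cyclicLT {x y z : ℕ} (hxy : x ≠ y) (hyz : y ≠ z) (hzx : z ≠ x) :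
    CyclicLT x y z ∨ CyclicLT z y x := by
  unfold CyclicLT; omega

lemma CyclicLT.trans {i w j k : ℕ} (h₁ : CyclicLT i w j) (h₂ : CyclicLT j k i) :
    CyclicLT w j k := by
  unfold CyclicLT at *; omega

lemma CyclicLT.asymm {x y z : ℕ} (h : CyclicLT x y z) : ¬ CyclicLT z y x := by
  unfold CyclicLT at *; omega

lemma CyclicLT.ne {x y z : ℕ} (h : CyclicLT x y z) : x ≠ y := by
  unfold CyclicLT at *; omega

lemma Interlaced.swap {a b c d : ℕ} (h : Interlaced a c b d) : Interlaced b d a c := by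
  rcases h with h | h | h | h | ⟨h₁, h₂⟩ | ⟨h₁, h₂⟩
  · exact Or.inl h.symm
  · exact Or.inr (Or.inr (Or.inl h.symm))
  · exact Or.inr (Or.inl h.symm)
  · exact Or.inr (Or.inr (Or.inr (Or.inl h.symm)))
  · exact Or.inr (Or.inr (Or.inr (Or.inr (Or.inr ⟨h₁.trans h₂, h₂.trans h₁⟩))))
  · exact Or.inr (Or.inr (Or.inr (Or.inr (Or.inl ⟨h₂.trans h₁, h₁.trans h₂⟩))))

lemma Interlaced.flip_left {a b c d : ℕ} (h : Interlaced a c b d) : Interlaced c a b d := by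
  unfold Interlaced at *; tauto

lemma Interlaced.flip_right {a b c d : ℕ} (h : Interlaced a c b d) : Interlaced a c d b := by
  unfold Interlaced at *; tauto

lemma same_side_of_not_interlaced {a b c d : ℕ} (h : ¬ Interlaced a c b d) (hac : a ≠ c) :
    (CyclicLT a c b ∧ CyclicLT a c d) ∨ (CyclicLT b c a ∧ CyclicLT d c a) := by
  unfold Interlaced at h
  push Not at h
  obtain ⟨hab, had, hcb, hcd, h₁, h₂⟩ := h
  rcases cyclicLT_or_cyclicLT hac hcb hab.symm with hb | hb <;>
    rcases cyclicLT_or_cyclicLT hac hcd had.symm with hd | hd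
  · exact Or.inl ⟨hb, hd⟩
  · exact absurd hb.rotate (h₂ hd.rotate.rotate)
  · exact absurd hd.rotate (h₁ hb.rotate.rotate)
  · exact Or.inr ⟨hb, hd⟩

lemma CyclicLT.exchange_of_interlaced_adjacent {i j k w : ℕ} (h : CyclicLT i j k) (hj : w ≠ j)
    (hk : w ≠ k) (hX : Interlaced i j w k ∨ Interlaced k i w j) : CyclicLT w j k := by
  have hjk := h.rotate.ne
  have hki := h.rotate.rotate.ne
  rcases hX with (e | e | e | e | ⟨h₁, h₂⟩ | ⟨h₁, -⟩) | (e | e | e | e | ⟨h₁, h₂⟩ | ⟨h₁, -⟩)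
  · exact e ▸ h
  · exact absurd e.symm hki
  · exact absurd e.symm hj
  · exact absurd e hjk
  · exact h₁.trans h₂
  · exact absurd h₁ h.rotate.asymm
  · exact absurd e.symm hk
  · exact absurd e.symm hjk
  · exact e ▸ h
  · exact absurd e h.ne
  · exact (h₂.trans h₁).rotate.rotate
  · exact absurd h₁ h.asymm

lemma CyclicLT.exchange_of_interlaced_opposite {i j k w : ℕ} (h : CyclicLT i j k) (hj : w ≠ j)
    (hk : w ≠ k) (hX : Interlaced j k w i) : CyclicLT k j w := by
  rcases hX with e | e | e | e | ⟨h₁, -⟩ | ⟨h₁, -⟩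
  · exact absurd e.symm hj
  · exact absurd e.symm h.ne
  · exact absurd e.symm hk
  · exact absurd e h.rotate.rotate.ne
  · exact h₁.rotate.rotate
  · exact absurd h₁ h.rotate.rotate.asymm

section Geometry

/-- Twice the signed area of the triangle `p q r`. -/
def signedArea (p q r : ℝ × ℝ) : ℝ :=
  (q.1 - p.1) * (r.2 - p.2) - (q.2 - p.2) * (r.1 - p.1)

lemma signedArea_rotate (p q r : ℝ × ℝ) : signedArea q r p = signedArea p q r := by
  unfold signedArea; ring

lemma signedArea_swap (p q r : ℝ × ℝ) : signedArea r q p = -signedArea p q r := by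
  unfold signedArea; ring

lemma signedArea_circlePt_neg {n : ℕ} {i j k : Fin n} (hij : i < j) (hjk : j < k) :
    signedArea (circlePt n i) (circlePt n j) (circlePt n k) < 0 := by
  have hn : (0 : ℝ) < n := by exact_mod_cast i.pos
  have hij' : (i.val : ℝ) < j.val := by exact_mod_cast hij
  have hjk' : (j.val : ℝ) < k.val := by exact_mod_cast hjk
  have hk : (k.val : ℝ) < n := by exact_mod_cast k.isLt
  have hi : (0 : ℝ) ≤ i.val := Nat.cast_nonneg _
  have hsin : ∀ t : ℝ, 0 < t → t < n → 0 < Real.sin (Real.pi * t / n) := fun t h0 h1 =>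
    Real.sin_pos_of_pos_of_lt_pi (by positivity) (by
      rw [div_lt_iff₀ hn]; exact mul_lt_mul_of_pos_left h1 Real.pi_pos)
  have hx := hsin (j.val - i.val) (by linarith) (by linarith)
  have hy := hsin (k.val - j.val) (by linarith) (by linarith)
  have hz := hsin (k.val - i.val) (by linarith) (by linarith)
  have hprod := mul_pos (mul_pos hx hy) hz
  unfold signedArea circlePt
  simp only
  set u := Real.pi * i.val / n with hu
  set v := Real.pi * j.val / n with hv
  set w := Real.pi * k.val / n with hw
  have e1 : 2 * Real.pi * i.val / n = 2 * u := by rw [hu]; ring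
  have e2 : 2 * Real.pi * j.val / n = 2 * v := by rw [hv]; ring
  have e3 : 2 * Real.pi * k.val / n = 2 * w := by rw [hw]; ring
  have e4 : Real.pi * ((j.val : ℝ) - i.val) / n = v - u := by rw [hu, hv]; ring
  have e5 : Real.pi * ((k.val : ℝ) - j.val) / n = w - v := by rw [hv, hw]; ring
  have e6 : Real.pi * ((k.val : ℝ) - i.val) / n = (v - u) + (w - v) := by rw [hu, hw]; ring
  rw [e4, e5, e6] at hprod
  rw [e1, e2, e3]
  have key : (Real.cos (2 * v) - Real.cos (2 * u)) * (-Real.sin (2 * w) - -Real.sin (2 * u)) -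
      (-Real.sin (2 * v) - -Real.sin (2 * u)) * (Real.cos (2 * w) - Real.cos (2 * u)) =
      Real.sin (2 * ((v - u) + (w - v))) - Real.sin (2 * (v - u)) - Real.sin (2 * (w - v)) := by
    have h1 : 2 * ((v - u) + (w - v)) = 2 * w - 2 * u := by ring
    have h2 : 2 * (v - u) = 2 * v - 2 * u := by ring
    have h3 : 2 * (w - v) = 2 * w - 2 * v := by ring
    rw [h1, h2, h3, Real.sin_sub, Real.sin_sub, Real.sin_sub]
    ring
  rw [key]
  generalize v - u = x at *
  generalize w - v = y at *
  have : Real.sin (2 * (x + y)) - Real.sin (2 * x) - Real.sin (2 * y) =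
      -4 * (Real.sin x * Real.sin y * Real.sin (x + y)) := by
    rw [Real.sin_two_mul, Real.sin_two_mul, Real.sin_two_mul, Real.sin_add, Real.cos_add]
    linear_combination
      (2 * Real.sin x * Real.cos x) * (Real.sin_sq_add_cos_sq y) +
      (2 * Real.sin y * Real.cos y) * (Real.sin_sq_add_cos_sq x)
  linarith

lemma signedArea_circlePt_neg_of_cyclicLT {n : ℕ} {i j k : Fin n} (h : CyclicLT i j k) :
    signedArea (circlePt n i) (circlePt n j) (circlePt n k) < 0 := by
  rcases h with ⟨h₁, h₂⟩ | ⟨h₁, h₂⟩ | ⟨h₁, h₂⟩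
  · exact signedArea_circlePt_neg h₁ h₂
  · rw [← signedArea_rotate]; exact signedArea_circlePt_neg h₁ h₂
  · rw [← signedArea_rotate, ← signedArea_rotate]; exact signedArea_circlePt_neg h₁ h₂

lemma circlePt_injective (n : ℕ) : Function.Injective (circlePt n) := by
  intro i j h
  have hn : (0 : ℝ) < n := by exact_mod_cast i.pos
  have hi : (i.val : ℝ) < n := by exact_mod_cast i.isLt
  have hj : (j.val : ℝ) < n := by exact_mod_cast j.isLt
  have hi0 : (0 : ℝ) ≤ i.val := Nat.cast_nonneg _
  have hj0 : (0 : ℝ) ≤ j.val := Nat.cast_nonneg _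
  have hc := congrArg Prod.fst h
  have hs := congrArg Prod.snd h
  simp only [circlePt, neg_inj] at hc hs
  have hcos : Real.cos (2 * Real.pi * i.val / n - 2 * Real.pi * j.val / n) = 1 := by
    rw [Real.cos_sub, hc, hs]
    linear_combination Real.sin_sq_add_cos_sq (2 * Real.pi * j.val / n)
  have hpi := Real.pi_pos
  have hlt : ∀ t : ℝ, t < n → 2 * Real.pi * t / n < 2 * Real.pi := fun t ht => by
    rw [div_lt_iff₀ hn]; exact mul_lt_mul_of_pos_left ht (by positivity)
  have hi1 := hlt _ hi
  have hj1 := hlt _ hj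
  have hi2 : 0 ≤ 2 * Real.pi * i.val / n := by positivity
  have hj2 : 0 ≤ 2 * Real.pi * j.val / n := by positivity
  have h0 := (Real.cos_eq_one_iff_of_lt_of_lt (by linarith) (by linarith)).1 hcos
  have : (i.val : ℝ) = j.val := by
    have h1 : 2 * Real.pi / n * ((i.val : ℝ) - j.val) = 0 := by rw [← h0]; ring
    have h2 : 2 * Real.pi / n ≠ 0 := by positivity
    linarith [(mul_eq_zero.1 h1).resolve_left h2]
  exact Fin.ext (by exact_mod_cast this)

lemma segment_inter_nonempty_of_signedArea_neg {p q r s : ℝ × ℝ}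
    (h₁ : signedArea p q r < 0) (h₂ : signedArea r s p < 0)
    (h₃ : signedArea q r s < 0) (h₄ : signedArea s p q < 0) :
    (segment ℝ p r ∩ segment ℝ q s).Nonempty := by
  have hsum : signedArea q r s + signedArea s p q = signedArea r s p + signedArea p q r := by
    unfold signedArea; ring
  have hne : signedArea q r s + signedArea s p q ≠ 0 := by linarith
  have hne' : signedArea r s p + signedArea p q r ≠ 0 := by linarith
  refine ⟨(signedArea q r s / (signedArea q r s + signedArea s p q)) • p +
      (signedArea s p q / (signedArea q r s + signedArea s p q)) • r,
    ⟨_, _, div_nonneg_of_nonpos (by linarith) (by linarith),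
      div_nonneg_of_nonpos (by linarith) (by linarith), ?_, rfl⟩,
    ⟨signedArea r s p / (signedArea r s p + signedArea p q r),
      signedArea p q r / (signedArea r s p + signedArea p q r),
      div_nonneg_of_nonpos (by linarith) (by linarith),
      div_nonneg_of_nonpos (by linarith) (by linarith), ?_, ?_⟩⟩
  · rw [← add_div, div_self hne]
  · rw [← add_div, div_self hne']
  · rw [← hsum]
    ext
    · simp only [Prod.fst_add, Prod.smul_fst, smul_eq_mul]
      rw [div_mul_eq_mul_div, div_mul_eq_mul_div, div_mul_eq_mul_div, div_mul_eq_mul_div,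
        ← add_div, ← add_div]
      congr 1
      unfold signedArea; ring
    · simp only [Prod.snd_add, Prod.smul_snd, smul_eq_mul]
      rw [div_mul_eq_mul_div, div_mul_eq_mul_div, div_mul_eq_mul_div, div_mul_eq_mul_div,
        ← add_div, ← add_div]
      congr 1
      unfold signedArea; ring

lemma signedArea_convexCombo (p q r s : ℝ × ℝ) {x y : ℝ} (h : x + y = 1) :
    signedArea p q (x • r + y • s) = x * signedArea p q r + y * signedArea p q s := by
  obtain rfl : y = 1 - x := by linarith
  simp only [signedArea, Prod.fst_add, Prod.smul_fst, Prod.snd_add, Prod.smul_snd, smul_eq_mul]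
  ring

lemma signedArea_eq_zero_of_mem_segment {p q z : ℝ × ℝ} (h : z ∈ segment ℝ p q) :
    signedArea p q z = 0 := by
  obtain ⟨x, y, -, -, hxy, rfl⟩ := h
  rw [signedArea_convexCombo _ _ _ _ hxy]
  unfold signedArea; ring

lemma segment_inter_eq_empty_of_signedArea_mul_pos {p q r s : ℝ × ℝ}
    (h : 0 < signedArea p q r * signedArea p q s) :
    ¬ (segment ℝ p q ∩ segment ℝ r s).Nonempty := by
  rintro ⟨z, hz, x, y, hx, hy, hxy, rfl⟩
  have h0 := signedArea_eq_zero_of_mem_segment hz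
  rw [signedArea_convexCombo _ _ _ _ hxy] at h0
  rcases pos_and_pos_or_neg_and_neg_of_mul_pos h with ⟨h₁, h₂⟩ | ⟨h₁, h₂⟩ <;>
  · rcases hx.eq_or_lt with rfl | hx
    · obtain rfl : y = 1 := by linarith
      linarith
    · nlinarith

lemma segment_inter_eq_empty_of_same_side {n : ℕ} {a b c d : Fin n}
    (h : (CyclicLT a c b ∧ CyclicLT a c d) ∨ (CyclicLT b c a ∧ CyclicLT d c a)) :
    ¬ (segment ℝ (circlePt n a) (circlePt n c) ∩
      segment ℝ (circlePt n b) (circlePt n d)).Nonempty := by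
  apply segment_inter_eq_empty_of_signedArea_mul_pos
  rcases h with ⟨h₁, h₂⟩ | ⟨h₁, h₂⟩
  · exact mul_pos_of_neg_of_neg (signedArea_circlePt_neg_of_cyclicLT h₁)
      (signedArea_circlePt_neg_of_cyclicLT h₂)
  · rw [signedArea_swap (circlePt n b), signedArea_swap (circlePt n d)]
    have := signedArea_circlePt_neg_of_cyclicLT h₁
    have := signedArea_circlePt_neg_of_cyclicLT h₂
    nlinarith

lemma segment_inter_nonempty_of_cyclicLT {n : ℕ} {a b c d : Fin n}
    (h₁ : CyclicLT a b c) (h₂ : CyclicLT c d a) :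
    (segment ℝ (circlePt n a) (circlePt n c) ∩
      segment ℝ (circlePt n b) (circlePt n d)).Nonempty := by
  have h₃ : CyclicLT b c d := by unfold CyclicLT at *; omega
  have h₄ : CyclicLT d a b := by unfold CyclicLT at *; omega
  exact segment_inter_nonempty_of_signedArea_neg
    (signedArea_circlePt_neg_of_cyclicLT h₁) (signedArea_circlePt_neg_of_cyclicLT h₂)
    (signedArea_circlePt_neg_of_cyclicLT h₃) (signedArea_circlePt_neg_of_cyclicLT h₄)

lemma segment_inter_nonempty_iff_interlaced {n : ℕ} (a b c d : Fin n) :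
    (segment ℝ (circlePt n a) (circlePt n c) ∩
      segment ℝ (circlePt n b) (circlePt n d)).Nonempty ↔ Interlaced a c b d := by
  constructor
  · intro h
    by_contra hcon
    by_cases hac : a = c
    · subst hac
      by_cases hbd : b = d
      · subst hbd
        simp only [segment_same] at h
        obtain ⟨z, hz₁, hz₂⟩ := h
        rw [Set.mem_singleton_iff] at hz₁ hz₂
        exact hcon (Or.inl (congrArg Fin.val (circlePt_injective n (hz₁.symm.trans hz₂))))
      · rw [Set.inter_comm] at h
        exact segment_inter_eq_empty_of_same_side
          (same_side_of_not_interlaced (mt Interlaced.swap hcon) (Fin.val_ne_of_ne hbd)) h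
    · exact segment_inter_eq_empty_of_same_side
        (same_side_of_not_interlaced hcon (Fin.val_ne_of_ne hac)) h
  · rintro (h | h | h | h | ⟨h₁, h₂⟩ | ⟨h₁, h₂⟩)
    · exact Fin.ext h ▸ ⟨_, left_mem_segment ℝ _ _, left_mem_segment ℝ _ _⟩
    · exact Fin.ext h ▸ ⟨_, left_mem_segment ℝ _ _, right_mem_segment ℝ _ _⟩
    · exact Fin.ext h ▸ ⟨_, right_mem_segment ℝ _ _, left_mem_segment ℝ _ _⟩
    · exact Fin.ext h ▸ ⟨_, right_mem_segment ℝ _ _, right_mem_segment ℝ _ _⟩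
    · exact segment_inter_nonempty_of_cyclicLT h₁ h₂
    · rw [segment_symm ℝ (circlePt n b)]
      exact segment_inter_nonempty_of_cyclicLT h₁ h₂

end Geometry

/-- `α` preserves interlacing of pairs. -/
def PreservesInterlaced {n : ℕ} (α : Fin n → Fin n) : Prop :=
  ∀ a b c d : Fin n, Interlaced a c b d → Interlaced (α a) (α c) (α b) (α d)

lemma chordProperty_iff_preservesInterlaced {n : ℕ} (α : Fin n → Fin n) :
    ChordProperty n α ↔ PreservesInterlaced α := by
  simp only [ChordProperty, PreservesInterlaced, segment_inter_nonempty_iff_interlaced]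

section Reversal

variable {n : ℕ}

lemma cyclicLT_rev (a b c : Fin n) :
    CyclicLT a.rev b.rev c.rev ↔ CyclicLT c b a := by
  simp only [CyclicLT, Fin.val_rev]
  omega

lemma interlaced_rev (a b c d : Fin n) :
    Interlaced a.rev c.rev b.rev d.rev ↔ Interlaced a c b d := by
  simp only [Interlaced, cyclicLT_rev, Fin.val_inj, Fin.rev_inj]
  tauto

lemma preservesInterlaced_rev {α : Fin n → Fin n} :
    PreservesInterlaced (fun i => (α i).rev) ↔ PreservesInterlaced α := by
  simp only [PreservesInterlaced, interlaced_rev]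

lemma isCyclicSeq_rev {α : Fin n → Fin n} :
    IsCyclicSeq (fun i => (α i).rev) ↔ IsAntiCyclicSeq α := by
  simp only [IsCyclicSeq, IsAntiCyclicSeq, Fin.rev_lt_rev]

end Reversal

lemma val_finRotate {n : ℕ} (i : Fin n) :
    ((finRotate n i).val = i.val + 1 ∧ i.val + 1 < n) ∨
      ((finRotate n i).val = 0 ∧ i.val + 1 = n) := by
  obtain _ | m := n
  · exact i.elim0
  · rcases (Nat.lt_succ_iff.1 i.isLt).lt_or_eq with h | h
    · left
      rw [coe_finRotate_of_ne_last (by intro e; simp [e] at h)]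
      omega
    · right
      obtain rfl : i = Fin.last m := Fin.ext h
      simp

section CyclicPreserves

variable {n : ℕ} {α : Fin n → Fin n}

lemma exists_descent {i j : Fin n} (hij : i ≤ j) (h : α j < α i) :
    ∃ k, i ≤ k ∧ k < j ∧ α (finRotate n k) < α k := by
  by_contra! hcon
  have key : ∀ m (hm : m < n), i.val ≤ m → m ≤ j.val → α i ≤ α ⟨m, hm⟩ := by
    intro m
    induction m with
    | zero =>
      intro hm h1 _
      have : i = ⟨0, hm⟩ := Fin.ext (by simpa using h1)
      rw [← this]
    | succ m ih =>
      intro hm h1 h2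
      rcases h1.eq_or_lt with h1 | h1
      · have : i = ⟨m + 1, hm⟩ := Fin.ext h1
        rw [← this]
      · have hm' : m < n := by omega
        refine (ih hm' (by omega) (by omega)).trans ?_
        have h3 := hcon ⟨m, hm'⟩ (Fin.le_def.2 (by simp only; omega))
          (Fin.lt_def.2 (by simp only; omega))
        have h4 : finRotate n ⟨m, hm'⟩ = ⟨m + 1, hm⟩ := by
          rcases val_finRotate (⟨m, hm'⟩ : Fin n) with h | h
          · exact Fin.ext h.1
          · simp only at h; omega
        rwa [h4] at h3
  exact absurd (key j j.isLt hij le_rfl) (not_le.2 h)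

lemma exists_descent_wrap {i j : Fin n} (h : α i < α j) :
    ∃ k, (j ≤ k ∨ k < i) ∧ α (finRotate n k) < α k := by
  by_contra! hcon
  have hn := i.pos
  let last : Fin n := ⟨n - 1, by omega⟩
  let first : Fin n := ⟨0, hn⟩
  have h₁ : α j ≤ α last := by
    by_contra! hlt
    obtain ⟨k, hk, -, hk'⟩ := exists_descent (Fin.le_def.2 (by simp only [last]; omega)) hlt
    exact absurd (hcon k (Or.inl hk)) (not_le.2 hk')
  have h₂ : α first ≤ α i := by
    by_contra! hlt
    obtain ⟨k, -, hk, hk'⟩ := exists_descent (Fin.le_def.2 (by simp [first])) hlt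
    exact absurd (hcon k (Or.inr hk)) (not_le.2 hk')
  have h₃ : α last ≤ α first := by
    have h₄ := hcon last (Or.inl (Fin.le_def.2 (by simp only [last]; omega)))
    have h₅ : finRotate n last = first := by
      rcases val_finRotate last with h | h
      · simp only [last] at h; omega
      · exact Fin.ext h.1
    rwa [h₅] at h₄
  exact absurd h (not_lt.2 (h₁.trans (h₃.trans h₂)))

lemma IsCyclicSeq.interlaced (hα : IsCyclicSeq α) {i j k l : Fin n}
    (hij : i < j) (hjk : j < k) (hkl : k < l) :
    Interlaced (α i) (α k) (α j) (α l) := by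
  have uniq : ∀ x y : Fin n, α (finRotate n x) < α x → α (finRotate n y) < α y → x = y := by
    intro x y hx hy
    exact Finset.card_le_one.1 hα x (by simpa using hx) y (by simpa using hy)
  have d₁ := exists_descent (α := α) hij.le
  have d₂ := exists_descent (α := α) hjk.le
  have d₃ := exists_descent (α := α) hkl.le
  have d₄ := exists_descent_wrap (α := α) (i := i) (j := l)
  have e₁₂ : ¬ (α j < α i ∧ α k < α j) := fun ⟨h, h'⟩ => by
    obtain ⟨x, hx⟩ := d₁ h
    obtain ⟨y, hy⟩ := d₂ h'
    have := uniq x y hx.2.2 hy.2.2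
    omega
  have e₁₃ : ¬ (α j < α i ∧ α l < α k) := fun ⟨h, h'⟩ => by
    obtain ⟨x, hx⟩ := d₁ h
    obtain ⟨y, hy⟩ := d₃ h'
    have := uniq x y hx.2.2 hy.2.2
    omega
  have e₁₄ : ¬ (α j < α i ∧ α i < α l) := fun ⟨h, h'⟩ => by
    obtain ⟨x, hx⟩ := d₁ h
    obtain ⟨y, hy⟩ := d₄ h'
    have := uniq x y hx.2.2 hy.2
    omega
  have e₂₃ : ¬ (α k < α j ∧ α l < α k) := fun ⟨h, h'⟩ => by
    obtain ⟨x, hx⟩ := d₂ h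
    obtain ⟨y, hy⟩ := d₃ h'
    have := uniq x y hx.2.2 hy.2.2
    omega
  have e₂₄ : ¬ (α k < α j ∧ α i < α l) := fun ⟨h, h'⟩ => by
    obtain ⟨x, hx⟩ := d₂ h
    obtain ⟨y, hy⟩ := d₄ h'
    have := uniq x y hx.2.2 hy.2
    omega
  have e₃₄ : ¬ (α l < α k ∧ α i < α l) := fun ⟨h, h'⟩ => by
    obtain ⟨x, hx⟩ := d₃ h
    obtain ⟨y, hy⟩ := d₄ h'
    have := uniq x y hx.2.2 hy.2
    omega
  clear d₁ d₂ d₃ d₄ uniq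
  simp only [Fin.lt_def] at *
  unfold Interlaced CyclicLT
  omega

lemma IsCyclicSeq.preservesInterlaced (hα : IsCyclicSeq α) : PreservesInterlaced α := by
  have left : ∀ a b c d : Fin n, a < c → b < d → Interlaced a c b d →
      Interlaced (α a) (α c) (α b) (α d) := by
    intro a b c d hac hbd h
    have : a = b ∨ a = d ∨ c = b ∨ c = d ∨ (a < b ∧ b < c ∧ c < d) ∨ (b < a ∧ a < d ∧ d < c) := by
      unfold Interlaced CyclicLT at h
      omega
    rcases this with rfl | rfl | rfl | rfl | ⟨h₁, h₂, h₃⟩ | ⟨h₁, h₂, h₃⟩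
    · simp [Interlaced]
    · simp [Interlaced]
    · simp [Interlaced]
    · simp [Interlaced]
    · exact hα.interlaced h₁ h₂ h₃
    · exact (hα.interlaced h₁ h₂ h₃).swap
  intro a b c d h
  have degenerate : a = c ∨ b = d → a = b ∨ a = d ∨ c = b ∨ c = d := by
    unfold Interlaced CyclicLT at h
    omega
  by_cases hdeg : a = c ∨ b = d
  · rcases degenerate hdeg with rfl | rfl | rfl | rfl <;> simp [Interlaced]
  · push Not at hdeg
    rcases lt_or_gt_of_ne hdeg.1 with hac | hac <;> rcases lt_or_gt_of_ne hdeg.2 with hbd | hbd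
    · exact left _ _ _ _ hac hbd h
    · exact (left _ _ _ _ hac hbd h.flip_right).flip_right
    · exact (left _ _ _ _ hac hbd h.flip_left).flip_left
    · exact (left _ _ _ _ hac hbd h.flip_left.flip_right).flip_right.flip_left

end CyclicPreserves

section PreservesCyclic

variable {n : ℕ} {α : Fin n → Fin n}

/-- `α` is injective on `i`, `j`, `k` and preserves their cyclic orientation. -/
def PreservesTriple (α : Fin n → Fin n) (i j k : Fin n) : Prop :=
  (CyclicLT i j k ∧ CyclicLT (α i) (α j) (α k)) ∨ (CyclicLT k j i ∧ CyclicLT (α k) (α j) (α i))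

/-- `α` is injective on `i`, `j`, `k` and reverses their cyclic orientation. -/
def ReversesTriple (α : Fin n → Fin n) (i j k : Fin n) : Prop :=
  (CyclicLT i j k ∧ CyclicLT (α k) (α j) (α i)) ∨ (CyclicLT k j i ∧ CyclicLT (α i) (α j) (α k))

lemma PreservesTriple.rotate {i j k : Fin n} (h : PreservesTriple α i j k) :
    PreservesTriple α j k i :=
  h.imp (fun h => ⟨h.1.rotate, h.2.rotate⟩) fun h => ⟨h.1.rotate.rotate, h.2.rotate.rotate⟩

lemma PreservesTriple.swap {i j k : Fin n} (h : PreservesTriple α i j k) :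
    PreservesTriple α k j i := Or.symm h

lemma PreservesTriple.map_ne {i j k : Fin n} (h : PreservesTriple α i j k) : α i ≠ α j := by
  unfold PreservesTriple CyclicLT at h; omega

lemma PreservesTriple.not_reversesTriple {i j k : Fin n} (h : PreservesTriple α i j k) :
    ¬ ReversesTriple α i j k := by
  unfold PreservesTriple ReversesTriple CyclicLT at *; omega

lemma PreservesInterlaced.exchange_of_cyclicLT (hα : PreservesInterlaced α) {i j k w : Fin n}
    (h : CyclicLT i j k) (h' : CyclicLT (α i) (α j) (α k)) (hj : α w ≠ α j) (hk : α w ≠ α k) :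
    PreservesTriple α w j k := by
  by_cases hwi : w = i
  · exact hwi ▸ Or.inl ⟨h, h'⟩
  have hwj : w.val ≠ j.val := fun e => hj (Fin.ext e ▸ rfl)
  have hwk : w.val ≠ k.val := fun e => hk (Fin.ext e ▸ rfl)
  have hwi : w.val ≠ i.val := Fin.val_ne_of_ne hwi
  have hj' := Fin.val_ne_of_ne hj
  have hk' := Fin.val_ne_of_ne hk
  have adjacent : Interlaced i j w k ∨ Interlaced k i w j → PreservesTriple α w j k := fun hX =>
    Or.inl ⟨h.exchange_of_interlaced_adjacent hwj hwk hX,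
      h'.exchange_of_interlaced_adjacent hj' hk' (hX.imp (hα _ _ _ _) (hα _ _ _ _))⟩
  have hcases : CyclicLT i w j ∨ CyclicLT j w k ∨ CyclicLT k w i := by
    clear * - h hwi hwj hwk
    unfold CyclicLT at *; omega
  rcases hcases with h₁ | h₁ | h₁
  · exact adjacent (Or.inl (Or.inr (Or.inr (Or.inr (Or.inr (Or.inl ⟨h₁, h.rotate⟩))))))
  · have hX : Interlaced j k w i :=
      Or.inr (Or.inr (Or.inr (Or.inr (Or.inl ⟨h₁, h.rotate.rotate⟩))))
    exact Or.inr ⟨h.exchange_of_interlaced_opposite hwj hwk hX,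
      h'.exchange_of_interlaced_opposite hj' hk' (hα _ _ _ _ hX)⟩
  · exact adjacent (Or.inr (Or.inr (Or.inr (Or.inr (Or.inr (Or.inl ⟨h₁, h⟩))))))

lemma PreservesInterlaced.exchange (hα : PreservesInterlaced α) {i j k w : Fin n}
    (h : PreservesTriple α i j k) (hj : α w ≠ α j) (hk : α w ≠ α k) :
    PreservesTriple α w j k := by
  rcases h with ⟨h, h'⟩ | ⟨h, h'⟩
  · exact hα.exchange_of_cyclicLT h h' hj hk
  · exact (hα.exchange_of_cyclicLT h.rotate.rotate h'.rotate.rotate hk hj).swap.rotate.rotate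

lemma PreservesInterlaced.preservesTriple_of_injective (hα : PreservesInterlaced α)
    {i j k x y z : Fin n} (h : PreservesTriple α i j k)
    (hxy : α x ≠ α y) (hyz : α y ≠ α z) (hzx : α z ≠ α x) : PreservesTriple α x y z := by
  have step₁ : ∃ p q, PreservesTriple α x p q := by
    by_cases hj : α x = α j
    · exact ⟨k, i, hα.exchange h.rotate (hj ▸ h.rotate.map_ne) (hj ▸ h.map_ne.symm)⟩
    · by_cases hk : α x = α k
      · exact ⟨i, j, hα.exchange h.rotate.rotate (hk ▸ h.rotate.rotate.map_ne) hj⟩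
      · exact ⟨j, k, hα.exchange h hj hk⟩
  obtain ⟨p, q, h₁⟩ := step₁
  have step₂ : ∃ r, PreservesTriple α x y r := by
    by_cases hq : α y = α q
    · have hp : α y ≠ α p := hq ▸ h₁.rotate.map_ne.symm
      exact ⟨p, (hα.exchange h₁.rotate.rotate hxy.symm hp).swap.rotate⟩
    · exact ⟨q, (hα.exchange h₁.rotate hq hxy.symm).rotate.rotate⟩
  obtain ⟨r, h₂⟩ := step₂
  exact (hα.exchange h₂.rotate.rotate hzx hyz.symm).rotate

lemma cyclicLT_or_of_interlaced {a b c d : ℕ} (h : Interlaced a c b d) (hab : b < a)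
    (hcd : d < c) : CyclicLT c b a ∨ CyclicLT a d c := by
  rcases h with h | h | h | h | ⟨h₁, h₂⟩ | ⟨h₁, h₂⟩
  · omega
  · unfold CyclicLT; omega
  · unfold CyclicLT; omega
  · omega
  · unfold CyclicLT at *; omega
  · exact Or.inl h₂

lemma PreservesInterlaced.exists_reversesTriple (hα : PreservesInterlaced α) {i j : Fin n}
    (hij : i ≠ j) (hi : α (finRotate n i) < α i) (hj : α (finRotate n j) < α j) :
    ∃ x y z, ReversesTriple α x y z := by
  have ri := val_finRotate i
  have rj := val_finRotate j
  generalize finRotate n i = i' at *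
  generalize finRotate n j = j' at *
  by_cases h₁ : i' = j
  · subst h₁
    have : j' ≠ i := by rintro rfl; exact absurd hi (not_lt.2 hj.le)
    refine ⟨i, i', j', Or.inl ?_⟩
    unfold CyclicLT
    omega
  by_cases h₂ : j' = i
  · subst h₂
    refine ⟨j, j', i', Or.inl ?_⟩
    unfold CyclicLT
    omega
  have p₁ : CyclicLT i i' j := by unfold CyclicLT; omega
  have p₂ : CyclicLT j j' i := by unfold CyclicLT; omega
  have hX := hα i i' j j' (by unfold Interlaced; tauto)
  have hcases : ReversesTriple α i i' j ∨ ReversesTriple α j j' i := by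
    have := cyclicLT_or_of_interlaced hX hi hj
    unfold ReversesTriple
    tauto
  rcases hcases with h | h
  · exact ⟨_, _, _, h⟩
  · exact ⟨_, _, _, h⟩

lemma reversesTriple_rev {i j k : Fin n} :
    ReversesTriple (fun i => (α i).rev) i j k ↔ PreservesTriple α i j k := by
  simp only [ReversesTriple, PreservesTriple, cyclicLT_rev]

lemma PreservesInterlaced.exists_reversesTriple_of_not_isCyclicSeq (hα : PreservesInterlaced α)
    (h : ¬ IsCyclicSeq α) : ∃ x y z, ReversesTriple α x y z := by
  obtain ⟨i, hi, j, hj, hij⟩ := Finset.one_lt_card.1 (not_le.1 h)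
  exact hα.exists_reversesTriple hij (by simpa using hi) (by simpa using hj)

lemma PreservesInterlaced.isCyclicSeq_or_isAntiCyclicSeq (hα : PreservesInterlaced α) :
    IsCyclicSeq α ∨ IsAntiCyclicSeq α := by
  by_contra! hcon
  obtain ⟨x, y, z, hneg⟩ := hα.exists_reversesTriple_of_not_isCyclicSeq hcon.1
  obtain ⟨i, j, k, hpos⟩ := (preservesInterlaced_rev.2 hα).exists_reversesTriple_of_not_isCyclicSeq
    (mt isCyclicSeq_rev.1 hcon.2)
  have hxyz : α x ≠ α y ∧ α y ≠ α z ∧ α z ≠ α x := by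
    unfold ReversesTriple CyclicLT at hneg
    omega
  exact (hα.preservesTriple_of_injective (reversesTriple_rev.1 hpos) hxyz.1 hxyz.2.1
    hxyz.2.2).not_reversesTriple hneg

end PreservesCyclic

/-- `α` has the chord property iff `α ∈ P_n = OP_n ∪ OR_n`. -/
theorem chord_property_iff_p (n : ℕ) (hn : 1 ≤ n) (α : Fin n → Fin n) :
    ChordProperty n α ↔ (IsCyclicSeq α ∨ IsAntiCyclicSeq α) := by
  rw [chordProperty_iff_preservesInterlaced]
  refine ⟨fun h => h.isCyclicSeq_or_isAntiCyclicSeq, ?_⟩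
  rintro (h | h)
  · exact h.preservesInterlaced
  · exact preservesInterlaced_rev.1 (isCyclicSeq_rev.2 h).preservesInterlaced
end
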